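/- For every dimension n ≥ 2, there exists no strictly increasing function Ψ: [0,∞) → ℝ such that the mapping F ↦ W(F) = Ψ(‖log U‖²) is rank-one convex on GL⁺(n), where U = √(FᵀF). -/

import Mathlib

open Matrix Real

attribute [local instance] Matrix.frobeniusNormedAddCommGroup Matrix.frobeniusNormedSpace

noncomputable section

/-- The space of real `n × n` matrices. -/
abbrev Mat (n : ℕ) := Matrix (Fin n) (Fin n) ℝ

/-- `GL⁺(n)`: real `n × n` matrices with positive determinant. -/
def GLp (n : ℕ) : Set (Mat n) := {F | 0 < F.det}

/-- Frobenius inner product `⟨X, Y⟩ = tr (X Yᵀ)`. -/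
def inn {n : ℕ} (X Y : Mat n) : ℝ := (X * Yᵀ).trace

/-- Squared Frobenius norm `‖X‖² = tr (Xᵀ X)`. -/
def nsq {n : ℕ} (X : Mat n) : ℝ := (Xᵀ * X).trace

/-- The primary matrix function associated to `f : ℝ → ℝ`: applies `f` to the eigenvalues
in a spectral decomposition of a Hermitian (i.e. real symmetric) matrix, junk value `0`
otherwise. -/
def matFun {n : ℕ} (f : ℝ → ℝ) (A : Mat n) : Mat n :=
  if hA : A.IsHermitian then
    (hA.eigenvectorUnitary : Mat n) * Matrix.diagonal (f ∘ hA.eigenvalues) *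
      (star (hA.eigenvectorUnitary : Mat n))
  else 0

/-- Principal square root of a symmetric positive semidefinite matrix. -/
def matSqrt {n : ℕ} (A : Mat n) : Mat n := matFun Real.sqrt A

/-- Principal matrix logarithm of a symmetric positive definite matrix. -/
def matLog {n : ℕ} (A : Mat n) : Mat n := matFun Real.log A

/-- `log U` where `U = √(FᵀF)` is the right stretch tensor of `F`. -/
def logU {n : ℕ} (F : Mat n) : Mat n := matLog (matSqrt (Fᵀ * F))

/-- `log V` where `V = √(FFᵀ)` is the left stretch tensor of `F`. -/
def logV {n : ℕ} (F : Mat n) : Mat n := matLog (matSqrt (F * Fᵀ))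

/-- Deviatoric (trace-free) part `dev_n X = X - (tr X / n) 𝟙`. -/
def dev {n : ℕ} (X : Mat n) : Mat n := X - (X.trace / n) • (1 : Mat n)

/-- Rank-one convexity of `W : GL⁺(n) → ℝ`: along every rank-one line segment contained in
`GL⁺(n)`, the function is convex. -/
def RankOneConvex {n : ℕ} (W : Mat n → ℝ) : Prop :=
  ∀ F ∈ GLp n, ∀ ξ η : Fin n → ℝ, ∀ I : Set ℝ, Convex ℝ I →
    (∀ t ∈ I, 0 < (F + t • vecMulVec ξ η).det) →
    ConvexOn ℝ I (fun t => W (F + t • vecMulVec ξ η))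

end

theorem roots_charpoly_diagonal {n : ℕ} (d : Fin n → ℝ) :
    (Matrix.diagonal d).charpoly.roots = Finset.univ.val.map d := by
  have h := Polynomial.roots_multiset_prod_X_sub_C (Finset.univ.val.map d)
  rw [Multiset.map_map] at h
  rw [Matrix.charpoly_diagonal]
  exact h

theorem isHermitian_matFun {n : ℕ} (f : ℝ → ℝ) {A : Mat n} (hA : A.IsHermitian) :
    (matFun f A).IsHermitian := by
  rw [matFun, dif_pos hA, Matrix.star_eq_conjTranspose]
  exact Matrix.isHermitian_mul_mul_conjTranspose _
    (Matrix.isHermitian_diagonal_of_self_adjoint _ (by ext; simp))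

/-- The spectral mapping theorem for `matFun`, with multiplicities. -/
theorem roots_charpoly_matFun {n : ℕ} (f : ℝ → ℝ) {A : Mat n} (hA : A.IsHermitian) :
    (matFun f A).charpoly.roots = A.charpoly.roots.map f := by
  rw [matFun, dif_pos hA, Matrix.charpoly_mul_comm, ← mul_assoc, Unitary.coe_star_mul_self, one_mul,
    roots_charpoly_diagonal, hA.roots_charpoly_eq_eigenvalues, Multiset.map_map]
  simp

theorem nsq_matFun {n : ℕ} (f : ℝ → ℝ) {A : Mat n} (hA : A.IsHermitian) :
    nsq (matFun f A) = (A.charpoly.roots.map fun x => f x ^ 2).sum := by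
  have hU : star (hA.eigenvectorUnitary : Mat n) * (hA.eigenvectorUnitary : Mat n) = 1 :=
    Unitary.coe_star_mul_self _
  have hT : (matFun f A)ᵀ = matFun f A := by
    simpa [Matrix.IsHermitian, Matrix.conjTranspose_eq_transpose_of_trivial]
      using isHermitian_matFun f hA
  rw [nsq, hT, matFun, dif_pos hA]
  set U := (hA.eigenvectorUnitary : Mat n)
  set D := Matrix.diagonal (f ∘ hA.eigenvalues)
  have h : U * D * star U * (U * D * star U) = U * (D * D * star U) := by
    calc _ = U * D * (star U * U) * D * star U := by simp only [mul_assoc]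
      _ = _ := by rw [hU]; simp only [mul_assoc, mul_one]
  rw [h, Matrix.trace_mul_comm, mul_assoc, hU, mul_one, hA.roots_charpoly_eq_eigenvalues,
    Multiset.map_map]
  simp [D, Matrix.diagonal_mul_diagonal, Matrix.trace_diagonal, Finset.sum, pow_two]

theorem nsq_logU {n : ℕ} (F : Mat n) :
    nsq (logU F) = ((Fᵀ * F).charpoly.roots.map fun x => log (√x) ^ 2).sum := by
  have hF : (Fᵀ * F).IsHermitian := by
    simpa [Matrix.conjTranspose_eq_transpose_of_trivial] using
      Matrix.isHermitian_conjTranspose_mul_self F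
  rw [logU, matLog, matSqrt, nsq_matFun _ (isHermitian_matFun _ hF), roots_charpoly_matFun _ hF,
    Multiset.map_map]
  rfl

/-- Block embedding of the `2 × 2` matrices into the `(2 + m) × (2 + m)` matrices,
completed by the identity. -/
def blockOne (m : ℕ) (M : Mat 2) : Mat (2 + m) :=
  Matrix.reindex finSumFinEquiv finSumFinEquiv (Matrix.fromBlocks M 0 0 1)

theorem det_blockOne (m : ℕ) (M : Mat 2) : (blockOne m M).det = M.det := by
  simp [blockOne]

theorem transpose_mul_blockOne (m : ℕ) (M : Mat 2) :
    (blockOne m M)ᵀ * blockOne m M = blockOne m (Mᵀ * M) := by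
  simp [blockOne, Matrix.fromBlocks_transpose, Matrix.submatrix_mul_equiv,
    Matrix.fromBlocks_multiply]

open Polynomial in
theorem charpoly_blockOne (m : ℕ) (M : Mat 2) :
    (blockOne m M).charpoly = M.charpoly * (X - 1) ^ m := by
  rw [blockOne, Matrix.charpoly_reindex, Matrix.charpoly_fromBlocks_zero₁₂, Matrix.charpoly_one]
  simp

open Polynomial in
theorem nsq_logU_blockOne (m : ℕ) (M : Mat 2) (x y : ℝ)
    (htr : (Mᵀ * M).trace = x + y) (hdet : M.det ^ 2 = x * y) :
    nsq (logU (blockOne m M)) = log (√x) ^ 2 + log (√y) ^ 2 := by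
  have h : (Mᵀ * M).charpoly = (X - C x) * (X - C y) := by
    rw [Matrix.charpoly_fin_two, htr, Matrix.det_mul, Matrix.det_transpose, ← pow_two, hdet]
    simp only [C_add, C_mul]
    ring
  have hx := X_sub_C_ne_zero x
  have hy := X_sub_C_ne_zero y
  have h1 : (X - 1 : ℝ[X]) ^ m ≠ 0 := pow_ne_zero _ (by simpa using X_sub_C_ne_zero (1 : ℝ))
  have hr : ((X - 1 : ℝ[X]) ^ m).roots = m • {1} := by
    rw [roots_pow, ← C_1, roots_X_sub_C]
  rw [nsq_logU, transpose_mul_blockOne, charpoly_blockOne, h, roots_mul (by positivity),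
    roots_mul (by positivity), hr]
  simp [Multiset.map_nsmul, Multiset.sum_nsmul]

theorem log_sqrt_four_pow (p : ℕ) : log (√(4 ^ p)) = p * log 2 := by
  rw [show (4 : ℝ) ^ p = (2 ^ p) ^ 2 by rw [← pow_mul, mul_comm, pow_mul]; norm_num,
    Real.sqrt_sq (by positivity), Real.log_pow]

theorem exists_add_sq_eq_and_mul_eq {S P : ℝ} (h₁ : 0 ≤ S + 2 * P) (h₂ : 0 ≤ S - 2 * P) :
    ∃ a b : ℝ, a ^ 2 + b ^ 2 = S ∧ a * b = P := by
  refine ⟨(√(S + 2 * P) + √(S - 2 * P)) / 2, (√(S + 2 * P) - √(S - 2 * P)) / 2, ?_, ?_⟩ <;>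
    nlinarith [Real.sq_sqrt h₁, Real.sq_sqrt h₂]

/-- A rank-one line along which `‖log U‖²` equals `145 log² 2`, `146 log² 2`, `144 log² 2` at three
consecutive points. -/
theorem exists_rankOne_line (m : ℕ) :
    ∃ (F : Mat (2 + m)) (ξ η : Fin (2 + m) → ℝ),
      (∀ s : ℝ, (F + s • vecMulVec ξ η).det = 131072 - s) ∧
      nsq (logU (F + (0 : ℝ) • vecMulVec ξ η)) = 145 * log 2 ^ 2 ∧
      nsq (logU (F + (65536 : ℝ) • vecMulVec ξ η)) = 146 * log 2 ^ 2 ∧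
      nsq (logU (F + (126976 : ℝ) • vecMulVec ξ η)) = 144 * log 2 ^ 2 := by
  obtain ⟨a, b, hS, hP⟩ := exists_add_sq_eq_and_mul_eq (S := 124713935699904 / 462725065)
    (P := 370203328512 / 2985323) (by norm_num) (by norm_num)
  obtain ⟨c, hc, hC⟩ : ∃ c : ℝ, c ≠ 0 ∧ c ^ 2 = 2600468480 / 2985323 :=
    ⟨√(2600468480 / 2985323), by positivity, Real.sq_sqrt (by norm_num)⟩
  set M : ℝ → Mat 2 := fun s => !![a, (s - 21088927744 / 2985323) / c; c, b] with hM
  have hline (s : ℝ) : blockOne m (M 0) + s • vecMulVec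
      (Sum.elim ![c⁻¹, 0] 0 ∘ finSumFinEquiv.symm) (Sum.elim ![0, 1] 0 ∘ finSumFinEquiv.symm)
      = blockOne m (M s) := by
    ext i j
    obtain ⟨i, rfl⟩ := finSumFinEquiv.surjective i
    obtain ⟨j, rfl⟩ := finSumFinEquiv.surjective j
    rcases i with i | i <;> rcases j with j | j
    · fin_cases i <;> fin_cases j <;>
        simp [blockOne, hM, vecMulVec_apply, -finSumFinEquiv_apply_left]
      ring
    all_goals simp [blockOne, vecMulVec_apply, -finSumFinEquiv_apply_left,
      -finSumFinEquiv_apply_right]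
  have hdet (s : ℝ) : (M s).det = 131072 - s := by
    rw [hM, Matrix.det_fin_two_of, hP, div_mul_cancel₀ _ hc]
    ring
  have htr (s : ℝ) : ((M s)ᵀ * M s).trace = 124713935699904 / 462725065 + 2600468480 / 2985323
      + (s - 21088927744 / 2985323) ^ 2 / (2600468480 / 2985323) := by
    rw [← hS, ← hC, ← div_pow]
    simp [hM, Matrix.trace_fin_two, Matrix.mul_apply, Fin.sum_univ_two]
    ring
  refine ⟨blockOne m (M 0), Sum.elim ![c⁻¹, 0] 0 ∘ finSumFinEquiv.symm,
    Sum.elim ![0, 1] 0 ∘ finSumFinEquiv.symm, fun s => ?_, ?_, ?_, ?_⟩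
  · rw [hline, det_blockOne, hdet]
  · rw [hline, nsq_logU_blockOne m _ (4 ^ 9) (4 ^ 8) (by rw [htr]; norm_num)
      (by rw [hdet]; norm_num), log_sqrt_four_pow, log_sqrt_four_pow]
    push_cast
    ring
  · rw [hline, nsq_logU_blockOne m _ (4 ^ 11) (4 ^ 5) (by rw [htr]; norm_num)
      (by rw [hdet]; norm_num), log_sqrt_four_pow, log_sqrt_four_pow]
    push_cast
    ring
  · rw [hline, nsq_logU_blockOne m _ (4 ^ 12) (4 ^ 0) (by rw [htr]; norm_num)
      (by rw [hdet]; norm_num), log_sqrt_four_pow, log_sqrt_four_pow]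
    push_cast
    ring

/-- **Proposition 4.1.** For every `n ≥ 2` there is no strictly increasing
`Ψ : [0,∞) → ℝ` such that `F ↦ Ψ(‖log U‖²)` (with `U = √(FᵀF)`) is rank-one convex
on `GL⁺(n)`. -/
theorem no_rank_one_convex_function_of_logU
    (n : ℕ) (hn : 2 ≤ n) :
    ¬ ∃ Ψ : ℝ → ℝ, StrictMonoOn Ψ (Set.Ici 0) ∧
      RankOneConvex (fun F : Mat n => Ψ (nsq (logU F))) := by
  obtain ⟨m, rfl⟩ := Nat.exists_eq_add_of_le hn
  rintro ⟨Ψ, hΨ, hW⟩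
  obtain ⟨F, ξ, η, hdet, h₀, h₁, h₂⟩ := exists_rankOne_line m
  have hlog : 0 < log 2 ^ 2 := by positivity
  have hF : F ∈ GLp (2 + m) := by
    have h := hdet 0
    rw [zero_smul, add_zero] at h
    simp [GLp, h]
  have hconv := hW F hF ξ η (Set.Icc 0 126976) (convex_Icc _ _) fun t ht => by
    rw [hdet]
    linarith [ht.2]
  have hmax := hconv.le_max_of_mem_Icc (x := 0) (y := 126976) (z := 65536)
    (by norm_num) (by norm_num) (by norm_num)
  simp only [h₀, h₁, h₂] at hmax
  refine hmax.not_gt (max_lt ?_ ?_) <;>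
    exact hΨ (Set.mem_Ici.2 (by positivity)) (Set.mem_Ici.2 (by positivity)) (by linarith)
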